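/- Under the setting of the proximal-Newton scheme for F := f + g with f standard self-concordant and g proper, lower semicontinuous, convex, let the iterates be x^{k+1} := x^k + (1+λ_k)⁻¹ d^k, where d^k := P^g_{∇²f(x^k)}(∇²f(x^k)x^k − ∇f(x^k)) − x^k, λ_k := ‖d^k‖_{x^k}, with each ∇²f(x^k) positive definite, and assume the unique minimizer x* of F satisfies ∇²f(x*) ≻ 0. If λ₀ ≤ σ̄ := √5 − 2, then λ_{k+1} ≤ λ_k for all k, λ_{k+1} ≤ (2/(1 − 2σ̄ − σ̄²)) λ_k², and the sequence {λ_k} converges to 0 at a quadratic rate. -/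

import Mathlib

open Matrix Set Filter Topology

noncomputable section

variable {n : ℕ}

/-- Weighted (semi)norm induced by a matrix `H`: `‖z‖_H = √(zᵀ H z)`. -/
def mNorm (H : Matrix (Fin n) (Fin n) ℝ) (z : Fin n → ℝ) : ℝ :=
  Real.sqrt (z ⬝ᵥ H.mulVec z)

/-- Dual weighted norm, `‖z‖*_H = √(zᵀ H⁻¹ z)`. -/
def mDualNorm (H : Matrix (Fin n) (Fin n) ℝ) (z : Fin n → ℝ) : ℝ :=
  Real.sqrt (z ⬝ᵥ H⁻¹.mulVec z)

/-- A function `g : ℝⁿ → ℝ ∪ {+∞}` (modelled with values in `EReal`) is proper. -/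
def EProper (g : (Fin n → ℝ) → EReal) : Prop :=
  (∀ x, g x ≠ ⊥) ∧ ∃ x, g x ≠ ⊤

/-- Convexity of an `EReal`-valued function on `ℝⁿ`. -/
def EConvex (g : (Fin n → ℝ) → EReal) : Prop :=
  ∀ x y : Fin n → ℝ, ∀ a b : ℝ, 0 ≤ a → 0 ≤ b → a + b = 1 →
    g (a • x + b • y) ≤ (a : EReal) * g x + (b : EReal) * g y

/-- `v` is a subgradient of `g` at `x`. -/
def ESubgradAt (g : (Fin n → ℝ) → EReal) (v x : Fin n → ℝ) : Prop :=
  g x ≠ ⊤ ∧ ∀ y, g x + ((v ⬝ᵥ (y - x) : ℝ) : EReal) ≤ g y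

/-- Objective of the proximal subproblem `g(x) + ½ xᵀHx − uᵀx`. -/
def proxObj (H : Matrix (Fin n) (Fin n) ℝ) (g : (Fin n → ℝ) → EReal)
    (u x : Fin n → ℝ) : EReal :=
  g x + ((1 / 2 * (x ⬝ᵥ H.mulVec x) - u ⬝ᵥ x : ℝ) : EReal)

/-- `p` solves the proximal subproblem, i.e. `p = P^g_H(u)`. -/
def IsProxPt (H : Matrix (Fin n) (Fin n) ℝ) (g : (Fin n → ℝ) → EReal)
    (u p : Fin n → ℝ) : Prop :=
  ∀ x, proxObj H g u p ≤ proxObj H g u x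

/-- The continuous linear map `y ↦ vᵀy`. -/
def dotCLM (v : Fin n → ℝ) : (Fin n → ℝ) →L[ℝ] ℝ :=
  LinearMap.toContinuousLinearMap
    { toFun := fun y => v ⬝ᵥ y
      map_add' := fun a b => dotProduct_add v a b
      map_smul' := fun c a => by simp }

/-- `f` is standard self-concordant on the open convex set `D`. -/
def StdSelfConcordantOn (D : Set (Fin n → ℝ)) (f : (Fin n → ℝ) → ℝ) : Prop :=
  IsOpen D ∧ Convex ℝ D ∧ ConvexOn ℝ D f ∧ ContDiffOn ℝ 3 f D ∧
    ∀ x ∈ D, ∀ v : Fin n → ℝ, ∀ t : ℝ, x + t • v ∈ D →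
      |iteratedDeriv 3 (fun s : ℝ => f (x + s • v)) t| ≤
        2 * iteratedDeriv 2 (fun s : ℝ => f (x + s • v)) t ^ ((3 : ℝ) / 2)

open scoped Classical in
/-- The extended objective `F = f + g`, equal to `+∞` outside `dom f`. -/
def Fext (D : Set (Fin n → ℝ)) (f : (Fin n → ℝ) → ℝ) (g : (Fin n → ℝ) → EReal)
    (x : Fin n → ℝ) : EReal :=
  if x ∈ D then (f x : EReal) + g x else ⊤

def omega (t : ℝ) : ℝ := t - Real.log (1 + t)

def omegaStar (t : ℝ) : ℝ := -t - Real.log (1 - t)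

lemma rpow_three_halves {X : ℝ} (hX : 0 ≤ X) : X ^ ((3 : ℝ) / 2) = √X ^ 3 := by
  rw [Real.sqrt_eq_rpow, ← Real.rpow_natCast, ← Real.rpow_mul hX]; norm_num

lemma abs_mixed_coeff_le_of_scaled {a b c d E F W : ℝ} (hE : 0 ≤ E) (hW : 0 ≤ W)
    (hnn : ∀ s t : ℝ, 0 ≤ s ^ 2 * E + 2 * s * t * F + t ^ 2 * W)
    (h : ∀ s t : ℝ, |a * s ^ 3 + 3 * b * s ^ 2 * t + 3 * c * s * t ^ 2 + d * t ^ 3| ≤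
      2 * (s ^ 2 * E + 2 * s * t * F + t ^ 2 * W) ^ ((3 : ℝ) / 2))
    {A B : ℝ} (hA : √E < A) (hB : √W < B) : |c| ≤ 5 / 2 * A * B ^ 2 := by
  have hA0 : 0 < A := (Real.sqrt_nonneg _).trans_lt hA
  have hB0 : 0 < B := (Real.sqrt_nonneg _).trans_lt hB
  have hEA : (1 / A) ^ 2 * E ≤ 1 := by
    have : E < A ^ 2 := (Real.sqrt_lt' hA0).1 hA
    rw [div_pow, one_pow, one_div, inv_mul_le_iff₀ (by positivity)]; linarith
  have hWB : (2 / B) ^ 2 * W ≤ 4 := by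
    have : W < B ^ 2 := (Real.sqrt_lt' hB0).1 hB
    rw [div_pow, div_mul_eq_mul_div, div_le_iff₀ (by positivity)]; linarith
  set s := 1 / A with hs
  set t := 2 / B with ht
  have h1 := h s t
  have h2 := h s (-t)
  have h3 := h s 0
  have n1 := hnn s t
  have n2 := hnn s (-t)
  have n4 := hnn s (-(t / 2))
  have n5 := hnn s (t / 2)
  have n3 : 0 ≤ s ^ 2 * E := by positivity
  have n6 : 0 ≤ t ^ 2 * W := by positivity
  rw [rpow_three_halves n1] at h1
  rw [rpow_three_halves n2] at h2
  have e3 : s ^ 2 * E + 2 * s * 0 * F + 0 ^ 2 * W = s ^ 2 * E := by ring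
  rw [e3, rpow_three_halves n3] at h3
  set p := √(s ^ 2 * E + 2 * s * t * F + t ^ 2 * W)
  set q := √(s ^ 2 * E + 2 * s * (-t) * F + (-t) ^ 2 * W)
  set r := √(s ^ 2 * E)
  have hp : p ^ 2 = s ^ 2 * E + 2 * s * t * F + t ^ 2 * W := Real.sq_sqrt n1
  have hq : q ^ 2 = s ^ 2 * E + 2 * s * (-t) * F + (-t) ^ 2 * W := Real.sq_sqrt n2
  have hp0 : 0 ≤ p := Real.sqrt_nonneg _
  have hq0 : 0 ≤ q := Real.sqrt_nonneg _
  have hr0 : 0 ≤ r := Real.sqrt_nonneg _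
  have hr1 : r ≤ 1 := Real.sqrt_le_one.2 hEA
  have hp3 : p ≤ 3 := by nlinarith
  have hq3 : q ≤ 3 := by nlinarith
  have hr3 : r ^ 3 ≤ 1 := pow_le_one₀ hr0 hr1
  have hpq : p ^ 2 + q ^ 2 ≤ 10 := by nlinarith
  have hcube : ∀ y : ℝ, 1 ≤ y → y ≤ 3 → y ^ 3 ≤ 1 + 13 / 4 * (y ^ 2 - 1) := fun y h1 h3 => by
    nlinarith [mul_nonneg (mul_nonneg (sub_nonneg.2 h1) (sub_nonneg.2 h3))
      (by linarith : 0 ≤ 4 * y + 3)]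
  have key : p ^ 3 + q ^ 3 ≤ 28 := by
    rcases le_total p 1 with h | h
    · have := pow_le_one₀ hp0 h (n := 3)
      have := pow_le_pow_left₀ hq0 hq3 3
      linarith
    rcases le_total q 1 with h' | h'
    · have := pow_le_one₀ hq0 h' (n := 3)
      have := pow_le_pow_left₀ hp0 hp3 3
      linarith
    linarith [hcube p h hp3, hcube q h' hq3]
  have h6 : |6 * c * s * t ^ 2| ≤ 60 := by
    rw [abs_le] at h1 h2 h3 ⊢
    have e : 6 * c * s * t ^ 2 =
        (a * s ^ 3 + 3 * b * s ^ 2 * t + 3 * c * s * t ^ 2 + d * t ^ 3) +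
        (a * s ^ 3 + 3 * b * s ^ 2 * (-t) + 3 * c * s * (-t) ^ 2 + d * (-t) ^ 3) -
        2 * (a * s ^ 3 + 3 * b * s ^ 2 * 0 + 3 * c * s * 0 ^ 2 + d * 0 ^ 3) := by ring
    rw [e]
    constructor <;> linarith
  have : 6 * c * s * t ^ 2 = c * (24 / (A * B ^ 2)) := by
    rw [hs, ht]; field_simp; ring
  rw [this, abs_mul, abs_of_pos (show (0:ℝ) < 24 / (A * B ^ 2) by positivity), ← mul_div_assoc,
    div_le_iff₀ (by positivity)] at h6
  linarith

/-- A binary cubic form dominated by the `3/2` power of a semidefinite quadratic form: bound on its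
mixed coefficient. -/
lemma abs_mixed_coeff_le {a b c d E F W : ℝ} (hE : 0 ≤ E) (hW : 0 ≤ W)
    (hnn : ∀ s t : ℝ, 0 ≤ s ^ 2 * E + 2 * s * t * F + t ^ 2 * W)
    (h : ∀ s t : ℝ, |a * s ^ 3 + 3 * b * s ^ 2 * t + 3 * c * s * t ^ 2 + d * t ^ 3| ≤
      2 * (s ^ 2 * E + 2 * s * t * F + t ^ 2 * W) ^ ((3 : ℝ) / 2)) :
    |c| ≤ 5 / 2 * √E * W := by
  have hcont : Continuous fun ε : ℝ => 5 / 2 * (√E + ε) * (√W + ε) ^ 2 := by fun_prop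
  have hlim := (hcont.tendsto 0).mono_left (nhdsWithin_le_nhds (s := Ioi 0))
  simp only [add_zero, Real.sq_sqrt hW] at hlim
  refine ge_of_tendsto hlim ?_
  filter_upwards [self_mem_nhdsWithin] with ε (hε : 0 < ε)
  exact abs_mixed_coeff_le_of_scaled hE hW hnn h (by linarith) (by linarith)

/-- Discriminant form of the Cauchy-Schwarz inequality: `Pu`, `Pw`, `Bx` stand for `P u u`, `P w w`
and `B u w`, where the bilinear form `B` is dominated by `β` times the semidefinite form `P`. -/
lemma abs_le_of_quadratic {β Bx Pu Pw : ℝ} (hβ : 0 ≤ β) (hu : 0 ≤ Pu) (hw : 0 ≤ Pw)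
    (h : ∀ s : ℝ, 2 * s * Bx ≤ β * (s ^ 2 * Pu + Pw)) : |Bx| ≤ β * √Pu * √Pw := by
  have hd := discrim_le_zero (a := β * Pu) (b := -(2 * Bx)) (c := β * Pw)
    (fun s => by nlinarith [h s])
  refine abs_le_of_sq_le_sq ?_ (by positivity)
  rw [mul_pow, mul_pow, Real.sq_sqrt hu, Real.sq_sqrt hw]
  rw [discrim] at hd
  nlinarith

lemma exp_le_one_add_mul {y : ℝ} (h0 : 0 ≤ y) (h1 : y ≤ 3 / 5) :
    Real.exp y ≤ 1 + 11 / 8 * y := by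
  have he : Real.exp (3 / 5) ≤ 1.825 := by
    refine le_of_pow_le_pow_left₀ (n := 5) (by norm_num) (by norm_num) ?_
    rw [← Real.exp_nat_mul]
    have : ((5 : ℕ) : ℝ) * (3 / 5) = ((3 : ℕ) : ℝ) * 1 := by norm_num
    rw [this, Real.exp_nat_mul]
    calc Real.exp 1 ^ 3 ≤ 2.7182818286 ^ 3 :=
          pow_le_pow_left₀ (Real.exp_pos _).le Real.exp_one_lt_d9.le 3
      _ ≤ _ := by norm_num
  have hc := convexOn_exp.2 (mem_univ 0) (mem_univ (3 / 5))
    (show 0 ≤ 1 - y / (3 / 5) by linarith) (show 0 ≤ y / (3 / 5) by positivity) (by ring)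
  simp only [smul_eq_mul, mul_zero, zero_add, Real.exp_zero, mul_one] at hc
  rw [div_mul_cancel₀ _ (by norm_num)] at hc
  nlinarith

/-- A standard self-concordant function together with its gradient and Hessian. -/
structure SelfConcordantSystem (D : Set (Fin n → ℝ)) (f : (Fin n → ℝ) → ℝ)
    (f' : (Fin n → ℝ) → Fin n → ℝ) (f'' : (Fin n → ℝ) → Matrix (Fin n) (Fin n) ℝ) : Prop where
  sc : StdSelfConcordantOn D f
  grad : ∀ x ∈ D, HasFDerivAt f (dotCLM (f' x)) x
  hess : ∀ x ∈ D, HasFDerivAt f' (LinearMap.toContinuousLinearMap (f'' x).mulVecLin) x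

/-- The matrix `H` as a continuous linear map. -/
def mulVecCLM (H : Matrix (Fin n) (Fin n) ℝ) : (Fin n → ℝ) →L[ℝ] (Fin n → ℝ) :=
  LinearMap.toContinuousLinearMap H.mulVecLin

@[simp] lemma mulVecCLM_apply (H : Matrix (Fin n) (Fin n) ℝ) (v : Fin n → ℝ) :
    mulVecCLM H v = H *ᵥ v := rfl

@[simp] lemma dotCLM_apply (v w : Fin n → ℝ) : dotCLM v w = v ⬝ᵥ w := rfl

/-- `dotCLM` as a continuous linear map. -/
def dotCLML : (Fin n → ℝ) →L[ℝ] (Fin n → ℝ) →L[ℝ] ℝ :=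
  LinearMap.toContinuousLinearMap
    { toFun := dotCLM
      map_add' := fun a b => by ext1 y; simp
      map_smul' := fun c a => by ext1 y; simp }

@[simp] lemma dotCLML_apply (v : Fin n → ℝ) : dotCLML v = dotCLM v := rfl

lemma hasDerivAt_line (x e : Fin n → ℝ) (t : ℝ) : HasDerivAt (fun s : ℝ => x + s • e) e t := by
  simpa using ((hasDerivAt_id t).smul_const e).const_add x

namespace SelfConcordantSystem

variable {D : Set (Fin n → ℝ)} {f : (Fin n → ℝ) → ℝ} {f' : (Fin n → ℝ) → Fin n → ℝ}
  {f'' : (Fin n → ℝ) → Matrix (Fin n) (Fin n) ℝ} {x : Fin n → ℝ}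

lemma eventually_mem (S : SelfConcordantSystem D f f' f'') (hx : x ∈ D) : ∀ᶠ y in 𝓝 x, y ∈ D :=
  S.sc.1.mem_nhds hx

lemma eventually_line_mem (S : SelfConcordantSystem D f f' f'') {e : Fin n → ℝ} {t : ℝ}
    (hx : x + t • e ∈ D) : ∀ᶠ s in 𝓝 t, x + s • e ∈ D :=
  (hasDerivAt_line x e t).continuousAt.eventually (S.eventually_mem hx)

lemma hess_symm (S : SelfConcordantSystem D f f' f'') (hx : x ∈ D) (u v : Fin n → ℝ) :
    u ⬝ᵥ f'' x *ᵥ v = v ⬝ᵥ f'' x *ᵥ u := by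
  have h2 : HasFDerivAt (fun y => dotCLM (f' y)) (dotCLML ∘L mulVecCLM (f'' x)) x :=
    dotCLML.hasFDerivAt.comp x (S.hess x hx)
  have := second_derivative_symmetric_of_eventually
    ((S.eventually_mem hx).mono fun y hy => S.grad y hy) h2 v u
  simpa [dotProduct_comm] using this

lemma contDiffOn_grad (S : SelfConcordantSystem D f f' f'') : ContDiffOn ℝ 2 f' D := by
  have h1 : ContDiffOn ℝ 2 (fderiv ℝ f) D :=
    S.sc.2.2.2.1.fderiv_of_isOpen S.sc.1 (by norm_num)
  rw [contDiffOn_pi]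
  intro i
  have h2 : ContDiffOn ℝ 2 (fun y => fderiv ℝ f y (Pi.single i 1)) D :=
    h1.clm_apply contDiffOn_const
  refine h2.congr fun y hy => ?_
  rw [(S.grad y hy).fderiv]
  simp

lemma exists_third (S : SelfConcordantSystem D f f' f'') (hx : x ∈ D) :
    ∃ T : (Fin n → ℝ) →L[ℝ] (Fin n → ℝ) →L[ℝ] (Fin n → ℝ),
      HasFDerivAt (fun y => mulVecCLM (f'' y)) T x := by
  have h1 : ContDiffOn ℝ 1 (fderiv ℝ f') D :=
    S.contDiffOn_grad.fderiv_of_isOpen S.sc.1 (by norm_num)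
  have h2 : DifferentiableAt ℝ (fderiv ℝ f') x :=
    (h1.differentiableOn (by norm_num)).differentiableAt (S.sc.1.mem_nhds hx)
  refine ⟨_, h2.hasFDerivAt.congr_of_eventuallyEq ?_⟩
  filter_upwards [S.eventually_mem hx] with y hy
  exact (S.hess y hy).fderiv.symm

lemma third_symm_right (S : SelfConcordantSystem D f f' f'') (hx : x ∈ D)
    {T : (Fin n → ℝ) →L[ℝ] (Fin n → ℝ) →L[ℝ] (Fin n → ℝ)}
    (hT : HasFDerivAt (fun y => mulVecCLM (f'' y)) T x) (u v : Fin n → ℝ) : T u v = T v u :=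
  second_derivative_symmetric_of_eventually
    ((S.eventually_mem hx).mono fun y hy => S.hess y hy) hT u v

lemma hasFDerivAt_quad {T : (Fin n → ℝ) →L[ℝ] (Fin n → ℝ) →L[ℝ] (Fin n → ℝ)}
    (hT : HasFDerivAt (fun y => mulVecCLM (f'' y)) T x) (u v : Fin n → ℝ) :
    HasFDerivAt (fun y => u ⬝ᵥ f'' y *ᵥ v)
      (dotCLM u ∘L (ContinuousLinearMap.apply ℝ _ v) ∘L T) x :=
  ((dotCLM u ∘L (ContinuousLinearMap.apply ℝ _ v)).hasFDerivAt).comp x hT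

lemma third_symm_left (S : SelfConcordantSystem D f f' f'') (hx : x ∈ D)
    {T : (Fin n → ℝ) →L[ℝ] (Fin n → ℝ) →L[ℝ] (Fin n → ℝ)}
    (hT : HasFDerivAt (fun y => mulVecCLM (f'' y)) T x) (e u v : Fin n → ℝ) :
    u ⬝ᵥ T e v = v ⬝ᵥ T e u := by
  have h1 := hasFDerivAt_quad hT u v
  have h2 := (hasFDerivAt_quad hT v u).congr_of_eventuallyEq
    ((S.eventually_mem hx).mono fun y hy => S.hess_symm hy u v)
  simpa using DFunLike.congr_fun (h1.unique h2) e

lemma hasDerivAt_quad_line {e : Fin n → ℝ} {t : ℝ}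
    {T : (Fin n → ℝ) →L[ℝ] (Fin n → ℝ) →L[ℝ] (Fin n → ℝ)}
    (hT : HasFDerivAt (fun y => mulVecCLM (f'' y)) T (x + t • e)) (u v : Fin n → ℝ) :
    HasDerivAt (fun s : ℝ => u ⬝ᵥ f'' (x + s • e) *ᵥ v) (u ⬝ᵥ T e v) t :=
  HasFDerivAt.comp_hasDerivAt (f := fun s : ℝ => x + s • e) t (hasFDerivAt_quad hT u v)
    (hasDerivAt_line x e t)

lemma hasDerivAt_grad_line (S : SelfConcordantSystem D f f' f'') {e : Fin n → ℝ} {t : ℝ}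
    (hx : x + t • e ∈ D) (u : Fin n → ℝ) :
    HasDerivAt (fun s : ℝ => u ⬝ᵥ f' (x + s • e)) (u ⬝ᵥ f'' (x + t • e) *ᵥ e) t :=
  HasFDerivAt.comp_hasDerivAt (f := fun s : ℝ => x + s • e) t
    ((dotCLM u).hasFDerivAt.comp (x + t • e) (S.hess _ hx)) (hasDerivAt_line x e t)

lemma deriv_line (S : SelfConcordantSystem D f f' f'') {e : Fin n → ℝ} {t : ℝ}
    (hx : x + t • e ∈ D) : HasDerivAt (fun s : ℝ => f (x + s • e)) (e ⬝ᵥ f' (x + t • e)) t := by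
  rw [dotProduct_comm]
  exact (S.grad _ hx).comp_hasDerivAt t (hasDerivAt_line x e t)

lemma deriv_line_eventuallyEq (S : SelfConcordantSystem D f f' f'') {e : Fin n → ℝ} {t : ℝ}
    (hx : x + t • e ∈ D) :
    deriv (fun s : ℝ => f (x + s • e)) =ᶠ[𝓝 t] fun s => e ⬝ᵥ f' (x + s • e) :=
  (S.eventually_line_mem hx).mono fun _ hs => (S.deriv_line hs).deriv

lemma iteratedDeriv_two_line (S : SelfConcordantSystem D f f' f'') {e : Fin n → ℝ} {t : ℝ}
    (hx : x + t • e ∈ D) :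
    iteratedDeriv 2 (fun s : ℝ => f (x + s • e)) t = e ⬝ᵥ f'' (x + t • e) *ᵥ e := by
  rw [iteratedDeriv_succ, iteratedDeriv_one, (S.deriv_line_eventuallyEq hx).deriv_eq]
  exact (S.hasDerivAt_grad_line hx e).deriv

lemma iteratedDeriv_three_line (S : SelfConcordantSystem D f f' f'') {e : Fin n → ℝ} {t : ℝ}
    (hx : x + t • e ∈ D) {T : (Fin n → ℝ) →L[ℝ] (Fin n → ℝ) →L[ℝ] (Fin n → ℝ)}
    (hT : HasFDerivAt (fun y => mulVecCLM (f'' y)) T (x + t • e)) :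
    iteratedDeriv 3 (fun s : ℝ => f (x + s • e)) t = e ⬝ᵥ T e e := by
  have : iteratedDeriv 2 (fun s : ℝ => f (x + s • e)) =ᶠ[𝓝 t]
      fun s => e ⬝ᵥ f'' (x + s • e) *ᵥ e :=
    (S.eventually_line_mem hx).mono fun _ hs => S.iteratedDeriv_two_line hs
  rw [iteratedDeriv_succ, this.deriv_eq]
  exact (hasDerivAt_quad_line hT e e).deriv

lemma hess_nonneg (S : SelfConcordantSystem D f f' f'') (hx : x ∈ D) (v : Fin n → ℝ) :
    0 ≤ v ⬝ᵥ f'' x *ᵥ v := by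
  set U : Set ℝ := {s | x + s • v ∈ D} with hU
  have hUo : IsOpen U := S.sc.1.preimage (by fun_prop)
  have h0 : (0 : ℝ) ∈ U := by simpa [hU] using hx
  have hconv : ConvexOn ℝ U fun s : ℝ => f (x + s • v) := by
    have := S.sc.2.2.1.comp_affineMap (AffineMap.lineMap x (x + v) : ℝ →ᵃ[ℝ] (Fin n → ℝ))
    simpa [Function.comp_def, AffineMap.lineMap_apply, add_comm, hU, preimage] using this
  have hmono := hconv.monotoneOn_deriv fun s hs => (S.deriv_line hs).differentiableAt
  have := hmono.derivWithin_nonneg (x := 0)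
  rw [derivWithin_of_isOpen hUo h0] at this
  have hx0 : x + (0 : ℝ) • v ∈ D := h0
  rw [(S.deriv_line_eventuallyEq hx0).deriv_eq, (S.hasDerivAt_grad_line hx0 v).deriv] at this
  simpa using this

lemma abs_third_diag_le (S : SelfConcordantSystem D f f' f'') (hx : x ∈ D)
    {T : (Fin n → ℝ) →L[ℝ] (Fin n → ℝ) →L[ℝ] (Fin n → ℝ)}
    (hT : HasFDerivAt (fun y => mulVecCLM (f'' y)) T x) (v : Fin n → ℝ) :
    |v ⬝ᵥ T v v| ≤ 2 * (v ⬝ᵥ f'' x *ᵥ v) ^ ((3 : ℝ) / 2) := by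
  have hx0 : x + (0 : ℝ) • v ∈ D := by simpa using hx
  have hT0 : HasFDerivAt (fun y => mulVecCLM (f'' y)) T (x + (0 : ℝ) • v) := by simpa using hT
  have := S.sc.2.2.2.2 x hx v 0 hx0
  rw [S.iteratedDeriv_three_line hx0 hT0, S.iteratedDeriv_two_line hx0] at this
  simpa using this

lemma abs_third_le (S : SelfConcordantSystem D f f' f'') (hx : x ∈ D)
    {T : (Fin n → ℝ) →L[ℝ] (Fin n → ℝ) →L[ℝ] (Fin n → ℝ)}
    (hT : HasFDerivAt (fun y => mulVecCLM (f'' y)) T x) (e v : Fin n → ℝ) :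
    |v ⬝ᵥ T e v| ≤ 5 / 2 * √(e ⬝ᵥ f'' x *ᵥ e) * (v ⬝ᵥ f'' x *ᵥ v) := by
  have hquad : ∀ s t : ℝ, (s • e + t • v) ⬝ᵥ f'' x *ᵥ (s • e + t • v) =
      s ^ 2 * (e ⬝ᵥ f'' x *ᵥ e) + 2 * s * t * (e ⬝ᵥ f'' x *ᵥ v) +
        t ^ 2 * (v ⬝ᵥ f'' x *ᵥ v) := by
    intro s t
    simp only [mulVec_add, mulVec_smul, add_dotProduct, dotProduct_add, smul_dotProduct,
      dotProduct_smul, smul_eq_mul, S.hess_symm hx v e]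
    ring
  have hcube : ∀ s t : ℝ, (s • e + t • v) ⬝ᵥ T (s • e + t • v) (s • e + t • v) =
      (e ⬝ᵥ T e e) * s ^ 3 + 3 * (e ⬝ᵥ T e v) * s ^ 2 * t + 3 * (v ⬝ᵥ T e v) * s * t ^ 2 +
        (v ⬝ᵥ T v v) * t ^ 3 := by
    intro s t
    have h1 : v ⬝ᵥ T e e = e ⬝ᵥ T e v := S.third_symm_left hx hT e v e
    have h2 : T v e = T e v := S.third_symm_right hx hT v e
    have h3 : e ⬝ᵥ T v v = v ⬝ᵥ T e v := by rw [S.third_symm_left hx hT v e v, h2]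
    simp only [map_add, map_smul, _root_.add_apply, _root_.smul_apply,
      add_dotProduct, dotProduct_add, smul_dotProduct, dotProduct_smul, smul_eq_mul, h1, h2, h3]
    ring
  refine abs_mixed_coeff_le (a := e ⬝ᵥ T e e) (b := e ⬝ᵥ T e v) (d := v ⬝ᵥ T v v)
    (F := e ⬝ᵥ f'' x *ᵥ v) (S.hess_nonneg hx e) (S.hess_nonneg hx v) ?_ ?_
  · intro s t
    rw [← hquad]
    exact S.hess_nonneg hx _
  · intro s t
    rw [← hquad, ← hcube]
    exact S.abs_third_diag_le hx hT _

lemma sqrt_quad_line_le (S : SelfConcordantSystem D f f' f'') {e : Fin n → ℝ}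
    (hseg : ∀ t ∈ Icc (0 : ℝ) 1, x + t • e ∈ D) (hr : √(e ⬝ᵥ f'' x *ᵥ e) < 1)
    {t : ℝ} (ht : t ∈ Icc (0 : ℝ) 1) :
    √(e ⬝ᵥ f'' (x + t • e) *ᵥ e) ≤ √(e ⬝ᵥ f'' x *ᵥ e) / (1 - √(e ⬝ᵥ f'' x *ᵥ e)) := by
  have hx : x ∈ D := by simpa using hseg 0 (by simp)
  set r := √(e ⬝ᵥ f'' x *ᵥ e) with hrdef
  have hr0 : 0 ≤ r := Real.sqrt_nonneg _
  have hrsq : r ^ 2 = e ⬝ᵥ f'' x *ᵥ e := Real.sq_sqrt (S.hess_nonneg hx e)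
  have hcont : ContinuousAt (fun ρ : ℝ => ρ / (1 - ρ)) r := by
    refine continuousAt_id.div (by fun_prop) (by simpa using (sub_pos.2 hr).ne')
  refine ge_of_tendsto (hcont.mono_left (nhdsWithin_le_nhds (s := Ioi r))) ?_
  filter_upwards [Ioo_mem_nhdsGT hr] with ρ hρ
  have hρ0 : 0 < ρ := hr0.trans_lt hρ.1
  set ε := ρ ^ 2 - r ^ 2 with hε
  have hε0 : 0 < ε := by have := hρ.1; rw [hε]; nlinarith
  set y : ℝ → ℝ := fun s => √(e ⬝ᵥ f'' (x + s • e) *ᵥ e + ε) with hy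
  have hypos : ∀ s ∈ Icc (0 : ℝ) 1, 0 < y s := fun s hs =>
    Real.sqrt_pos.2 (add_pos_of_nonneg_of_pos (S.hess_nonneg (hseg s hs) e) hε0)
  have hder : ∀ s ∈ Icc (0 : ℝ) 1, ∃ z, 0 ≤ z ∧ HasDerivAt (fun s => (y s)⁻¹ + s) z s := by
    intro s hs
    obtain ⟨T, hT⟩ := S.exists_third (hseg s hs)
    have hp := S.hess_nonneg (hseg s hs) e
    have h1 := (((hasDerivAt_quad_line hT e e).add_const ε).sqrt
      (add_pos_of_nonneg_of_pos hp hε0).ne').inv (hypos s hs).ne'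
    refine ⟨_, ?_, h1.add (hasDerivAt_id s)⟩
    have hb := S.abs_third_diag_le (hseg s hs) hT e
    rw [rpow_three_halves hp] at hb
    have hle : √(e ⬝ᵥ f'' (x + s • e) *ᵥ e) ^ 3 ≤ y s ^ 3 :=
      pow_le_pow_left₀ (Real.sqrt_nonneg _) (Real.sqrt_le_sqrt (by linarith)) 3
    have hTe : e ⬝ᵥ T e e ≤ 2 * y s ^ 3 := (le_abs_self _).trans (hb.trans (by linarith))
    have hys := hypos s hs
    change 0 ≤ -(e ⬝ᵥ T e e / (2 * y s)) / y s ^ 2 + 1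
    rw [neg_div, div_div, neg_add_eq_sub, sub_nonneg, div_le_one (by positivity)]
    linarith
  have hmono : MonotoneOn (fun s => (y s)⁻¹ + s) (Icc 0 1) := by
    refine monotoneOn_of_deriv_nonneg (convex_Icc 0 1) ?_ ?_ ?_
    · intro s hs
      obtain ⟨z, -, hz⟩ := hder s hs
      exact hz.continuousAt.continuousWithinAt
    · intro s hs
      obtain ⟨z, -, hz⟩ := hder s (interior_subset hs)
      exact hz.differentiableAt.differentiableWithinAt
    · intro s hs
      obtain ⟨z, hz0, hz⟩ := hder s (interior_subset hs)
      rwa [hz.deriv]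
  have h01 := hmono (by simp) ht ht.1
  have hy0 : y 0 = ρ := by
    simp only [hy, zero_smul, add_zero, ← hrsq, hε]
    rw [add_sub_cancel, Real.sqrt_sq hρ0.le]
  simp only [hy0, add_zero] at h01
  have hyt := hypos t ht
  have h2 : ρ⁻¹ - 1 ≤ (y t)⁻¹ := by linarith [ht.2]
  have h3 : ρ⁻¹ - 1 = (ρ / (1 - ρ))⁻¹ := by field_simp
  rw [h3] at h2
  have hρ1 : 0 < 1 - ρ := sub_pos.2 hρ.2
  exact (Real.sqrt_le_sqrt (by linarith)).trans ((inv_le_inv₀ (by positivity) hyt).1 h2)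

lemma quad_line_mem_Icc (S : SelfConcordantSystem D f f' f'') {e : Fin n → ℝ}
    (hseg : ∀ t ∈ Icc (0 : ℝ) 1, x + t • e ∈ D) {L : ℝ}
    (hL : ∀ t ∈ Icc (0 : ℝ) 1, √(e ⬝ᵥ f'' (x + t • e) *ᵥ e) ≤ L) (v : Fin n → ℝ)
    {t : ℝ} (ht : t ∈ Icc (0 : ℝ) 1) :
    v ⬝ᵥ f'' (x + t • e) *ᵥ v ∈ Icc (Real.exp (-(5 / 2 * L * t)) * (v ⬝ᵥ f'' x *ᵥ v))
      (Real.exp (5 / 2 * L * t) * (v ⬝ᵥ f'' x *ᵥ v)) := by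
  set q : ℝ → ℝ := fun s => v ⬝ᵥ f'' (x + s • e) *ᵥ v with hq
  have hder : ∀ s ∈ Icc (0 : ℝ) 1, ∃ z, |z| ≤ 5 / 2 * L * q s ∧ HasDerivAt q z s := by
    intro s hs
    obtain ⟨T, hT⟩ := S.exists_third (hseg s hs)
    refine ⟨_, (S.abs_third_le (hseg s hs) hT e v).trans ?_, hasDerivAt_quad_line hT v v⟩
    have := S.hess_nonneg (hseg s hs) v
    have := hL s hs
    gcongr
  have hexp : ∀ c s : ℝ, HasDerivAt (fun s => Real.exp (c * s)) (Real.exp (c * s) * c) s :=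
    fun c s => by simpa using ((hasDerivAt_id s).const_mul c).exp
  have hup : AntitoneOn (fun s => Real.exp (-(5 / 2 * L) * s) * q s) (Icc 0 1) := by
    refine antitoneOn_of_deriv_nonpos (convex_Icc 0 1) ?_ ?_ ?_
    · intro s hs
      obtain ⟨z, -, hz⟩ := hder s hs
      exact ((hexp _ s).mul hz).continuousAt.continuousWithinAt
    · intro s hs
      obtain ⟨z, -, hz⟩ := hder s (interior_subset hs)
      exact ((hexp _ s).mul hz).differentiableAt.differentiableWithinAt
    · intro s hs
      obtain ⟨z, hz0, hz⟩ := hder s (interior_subset hs)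
      refine ((hexp _ s).mul hz).deriv.le.trans ?_
      have := (abs_le.1 hz0).2
      have := Real.exp_pos (-(5 / 2 * L) * s)
      nlinarith
  have hlow : MonotoneOn (fun s => Real.exp (5 / 2 * L * s) * q s) (Icc 0 1) := by
    refine monotoneOn_of_deriv_nonneg (convex_Icc 0 1) ?_ ?_ ?_
    · intro s hs
      obtain ⟨z, -, hz⟩ := hder s hs
      exact ((hexp _ s).mul hz).continuousAt.continuousWithinAt
    · intro s hs
      obtain ⟨z, -, hz⟩ := hder s (interior_subset hs)
      exact ((hexp _ s).mul hz).differentiableAt.differentiableWithinAt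
    · intro s hs
      obtain ⟨z, hz0, hz⟩ := hder s (interior_subset hs)
      refine le_of_le_of_eq ?_ ((hexp _ s).mul hz).deriv.symm
      have := (abs_le.1 hz0).1
      have := Real.exp_pos (5 / 2 * L * s)
      nlinarith
  have h1 := hup (by simp) ht ht.1
  have h2 := hlow (by simp) ht ht.1
  have hq0 : q 0 = v ⬝ᵥ f'' x *ᵥ v := by simp [hq]
  simp only [mul_zero, Real.exp_zero, one_mul, hq0] at h1 h2
  rw [neg_mul, Real.exp_neg, inv_mul_le_iff₀ (Real.exp_pos _)] at h1
  refine ⟨?_, h1⟩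
  rw [Real.exp_neg, inv_mul_le_iff₀ (Real.exp_pos _)]
  exact h2

lemma abs_hess_sub_le (S : SelfConcordantSystem D f f' f'') {e : Fin n → ℝ}
    (hseg : ∀ t ∈ Icc (0 : ℝ) 1, x + t • e ∈ D) {L : ℝ} (hL0 : 0 ≤ L) (hL1 : L ≤ 6 / 25)
    (hL : ∀ t ∈ Icc (0 : ℝ) 1, √(e ⬝ᵥ f'' (x + t • e) *ᵥ e) ≤ L) (u w : Fin n → ℝ)
    {t : ℝ} (ht : t ∈ Icc (0 : ℝ) 1) :
    |u ⬝ᵥ f'' (x + t • e) *ᵥ w - u ⬝ᵥ f'' x *ᵥ w| ≤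
      55 / 16 * L * t * √(u ⬝ᵥ f'' x *ᵥ u) * √(w ⬝ᵥ f'' x *ᵥ w) := by
  have hx : x ∈ D := by simpa using hseg 0 (by simp)
  have ht0 := ht.1
  have hβ : 0 ≤ 55 / 16 * L * t := by positivity
  have hdiag : ∀ v : Fin n → ℝ, |v ⬝ᵥ f'' (x + t • e) *ᵥ v - v ⬝ᵥ f'' x *ᵥ v| ≤
      55 / 16 * L * t * (v ⬝ᵥ f'' x *ᵥ v) := by
    intro v
    obtain ⟨h1, h2⟩ := S.quad_line_mem_Icc hseg hL v ht
    have hv := S.hess_nonneg hx v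
    have hLt : 5 / 2 * L * t ≤ 3 / 5 := by nlinarith [ht.2]
    have e1 := mul_le_mul_of_nonneg_right
      (exp_le_one_add_mul (by positivity : 0 ≤ 5 / 2 * L * t) hLt) hv
    have e2 := mul_le_mul_of_nonneg_right (Real.add_one_le_exp (-(5 / 2 * L * t))) hv
    have e3 : 0 ≤ L * t * (v ⬝ᵥ f'' x *ᵥ v) := by positivity
    rw [abs_le]
    constructor <;> linarith
  refine abs_le_of_quadratic hβ (S.hess_nonneg hx u) (S.hess_nonneg hx w) fun s => ?_
  have h1 := (abs_le.1 (hdiag (s • u + w))).2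
  have h2 := (abs_le.1 (hdiag (s • u - w))).1
  simp only [mulVec_add, mulVec_sub, mulVec_smul, add_dotProduct, sub_dotProduct, dotProduct_add,
    dotProduct_sub, smul_dotProduct, dotProduct_smul, smul_eq_mul, S.hess_symm hx w u,
    S.hess_symm (hseg t ht) w u] at h1 h2
  linarith

lemma abs_grad_sub_le (S : SelfConcordantSystem D f f' f'') {e : Fin n → ℝ}
    (hseg : ∀ t ∈ Icc (0 : ℝ) 1, x + t • e ∈ D) {L : ℝ} (hL0 : 0 ≤ L) (hL1 : L ≤ 6 / 25)
    (hL : ∀ t ∈ Icc (0 : ℝ) 1, √(e ⬝ᵥ f'' (x + t • e) *ᵥ e) ≤ L) (w : Fin n → ℝ) :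
    |w ⬝ᵥ f' (x + e) - w ⬝ᵥ f' x - w ⬝ᵥ f'' x *ᵥ e| ≤
      55 / 32 * L * √(w ⬝ᵥ f'' x *ᵥ w) * √(e ⬝ᵥ f'' x *ᵥ e) := by
  set K := 55 / 16 * L * √(w ⬝ᵥ f'' x *ᵥ w) * √(e ⬝ᵥ f'' x *ᵥ e) with hK
  have hmain : ∀ σ : ℝ, |σ| = 1 →
      σ * (w ⬝ᵥ f' (x + e) - w ⬝ᵥ f' x - w ⬝ᵥ f'' x *ᵥ e) ≤ K / 2 := by
    intro σ hσ
    have hder : ∀ s ∈ Icc (0 : ℝ) 1, ∃ z, 0 ≤ z ∧ HasDerivAt (fun s : ℝ =>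
        K / 2 * s ^ 2 - σ * (w ⬝ᵥ f' (x + s • e) - s * (w ⬝ᵥ f'' x *ᵥ e))) z s := by
      intro s hs
      refine ⟨_, ?_, ((hasDerivAt_pow 2 s).const_mul (K / 2)).sub
        (((S.hasDerivAt_grad_line (hseg s hs) w).sub
          ((hasDerivAt_id s).mul_const (w ⬝ᵥ f'' x *ᵥ e))).const_mul σ)⟩
      have hb := S.abs_hess_sub_le hseg hL0 hL1 hL w e hs
      have h1 : σ * (w ⬝ᵥ f'' (x + s • e) *ᵥ e - w ⬝ᵥ f'' x *ᵥ e) ≤ K * s := by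
        refine (le_abs_self _).trans ?_
        rw [abs_mul, hσ, one_mul]
        exact hb.trans_eq (by rw [hK]; ring)
      norm_num
      linarith
    have hmono : MonotoneOn (fun s : ℝ =>
        K / 2 * s ^ 2 - σ * (w ⬝ᵥ f' (x + s • e) - s * (w ⬝ᵥ f'' x *ᵥ e))) (Icc 0 1) := by
      refine monotoneOn_of_deriv_nonneg (convex_Icc 0 1) ?_ ?_ ?_
      · intro s hs
        obtain ⟨z, -, hz⟩ := hder s hs
        exact hz.continuousAt.continuousWithinAt
      · intro s hs
        obtain ⟨z, -, hz⟩ := hder s (interior_subset hs)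
        exact hz.differentiableAt.differentiableWithinAt
      · intro s hs
        obtain ⟨z, hz0, hz⟩ := hder s (interior_subset hs)
        rwa [hz.deriv]
    have := hmono (left_mem_Icc.2 zero_le_one) (right_mem_Icc.2 zero_le_one) zero_le_one
    norm_num at this
    linarith
  have h1 := hmain 1 (by simp)
  have h2 := hmain (-1) (by simp)
  rw [abs_le]
  constructor <;> linarith

lemma abs_hess_le (S : SelfConcordantSystem D f f' f'') (hx : x ∈ D) (u w : Fin n → ℝ) :
    |u ⬝ᵥ f'' x *ᵥ w| ≤ √(u ⬝ᵥ f'' x *ᵥ u) * √(w ⬝ᵥ f'' x *ᵥ w) := by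
  rw [← one_mul √(u ⬝ᵥ f'' x *ᵥ u)]
  refine abs_le_of_quadratic zero_le_one (S.hess_nonneg hx u) (S.hess_nonneg hx w) fun s => ?_
  have h := S.hess_nonneg hx (s • u - w)
  simp only [mulVec_sub, mulVec_smul, sub_dotProduct, dotProduct_sub, smul_dotProduct,
    dotProduct_smul, smul_eq_mul, S.hess_symm hx w u] at h
  linarith

lemma mNorm_add_le (S : SelfConcordantSystem D f f' f'') (hx : x ∈ D) (u w : Fin n → ℝ) :
    mNorm (f'' x) (u + w) ≤ mNorm (f'' x) u + mNorm (f'' x) w := by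
  have h1 := (le_abs_self _).trans (S.abs_hess_le hx u w)
  refine Real.sqrt_le_iff.2 ⟨add_nonneg (Real.sqrt_nonneg _) (Real.sqrt_nonneg _), ?_⟩
  have hu := Real.sq_sqrt (S.hess_nonneg hx u)
  have hw := Real.sq_sqrt (S.hess_nonneg hx w)
  simp only [mNorm, mulVec_add, add_dotProduct, dotProduct_add, S.hess_symm hx w u]
  linarith

end SelfConcordantSystem

/-- First-order optimality for the proximal subproblem. -/
lemma IsProxPt.variational {H : Matrix (Fin n) (Fin n) ℝ} {g : (Fin n → ℝ) → EReal}
    (hsymm : ∀ a b : Fin n → ℝ, a ⬝ᵥ H *ᵥ b = b ⬝ᵥ H *ᵥ a)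
    (hproper : EProper g) (hconv : EConvex g) {u p : Fin n → ℝ} (hp : IsProxPt H g u p) :
    g p ≠ ⊤ ∧ ∀ y, g y ≠ ⊤ → (y - p) ⬝ᵥ (u - H *ᵥ p) ≤ (g y).toReal - (g p).toReal := by
  have hcoe : ∀ y, g y ≠ ⊤ → g y = ((g y).toReal : EReal) := fun y hy =>
    (EReal.coe_toReal hy (hproper.1 y)).symm
  have htop : g p ≠ ⊤ := by
    obtain ⟨y, hy⟩ := hproper.2
    intro h
    have := hp y
    rw [proxObj, proxObj, h, hcoe y hy, EReal.top_add_coe, ← EReal.coe_add, top_le_iff] at this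
    exact EReal.coe_ne_top _ this
  refine ⟨htop, fun y hy => ?_⟩
  have hstep : ∀ s : ℝ, s ∈ Ioo (0 : ℝ) 1 → (y - p) ⬝ᵥ (u - H *ᵥ p) ≤
      (g y).toReal - (g p).toReal + s * (1 / 2 * ((y - p) ⬝ᵥ H *ᵥ (y - p))) := by
    intro s hs
    have hc := hconv p y (1 - s) s (by linarith [hs.2]) hs.1.le (by ring)
    have hz : (1 - s) • p + s • y = p + s • (y - p) := by module
    rw [hz, hcoe p htop, hcoe y hy, ← EReal.coe_mul, ← EReal.coe_mul, ← EReal.coe_add] at hc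
    have ho := (hp (p + s • (y - p))).trans (add_le_add_left hc _)
    rw [proxObj, hcoe p htop, ← EReal.coe_add, ← EReal.coe_add, EReal.coe_le_coe_iff, EReal.toReal_coe] at ho
    simp only [mulVec_add, mulVec_smul, add_dotProduct, dotProduct_add, smul_dotProduct,
      dotProduct_smul, smul_eq_mul, hsymm p (y - p)] at ho
    rw [dotProduct_sub, dotProduct_comm (y - p) u]
    refine le_of_mul_le_mul_left ?_ hs.1
    linarith
  have hcont : Continuous fun s : ℝ =>
      (g y).toReal - (g p).toReal + s * (1 / 2 * ((y - p) ⬝ᵥ H *ᵥ (y - p))) := by fun_prop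
  have hlim := (hcont.tendsto 0).mono_left (nhdsWithin_le_nhds (s := Ioi 0))
  simp only [zero_mul, add_zero] at hlim
  refine ge_of_tendsto hlim ?_
  filter_upwards [Ioo_mem_nhdsGT one_pos] with s hs using hstep s hs

lemma mNorm_smul (H : Matrix (Fin n) (Fin n) ℝ) {c : ℝ} (hc : 0 ≤ c) (z : Fin n → ℝ) :
    mNorm H (c • z) = c * mNorm H z := by
  rw [mNorm, mNorm, mulVec_smul, smul_dotProduct, dotProduct_smul, smul_eq_mul, smul_eq_mul,
    ← mul_assoc, Real.sqrt_mul (mul_self_nonneg c), Real.sqrt_mul_self hc]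

/-- One damped proximal-Newton step contracts the Newton decrement quadratically. -/
lemma SelfConcordantSystem.mNorm_step_le {D : Set (Fin n → ℝ)} {f : (Fin n → ℝ) → ℝ}
    {f' : (Fin n → ℝ) → Fin n → ℝ} {f'' : (Fin n → ℝ) → Matrix (Fin n) (Fin n) ℝ}
    (S : SelfConcordantSystem D f f' f'') {g : (Fin n → ℝ) → EReal}
    (hproper : EProper g) (hconv : EConvex g) {x y d d' : Fin n → ℝ} {l : ℝ}
    (hx : x ∈ D) (hy : y ∈ D) (hl : l = mNorm (f'' x) d) (hl1 : l ≤ 6 / 25)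
    (hyx : y = x + (1 + l)⁻¹ • d)
    (hpx : IsProxPt (f'' x) g (f'' x *ᵥ x - f' x) (x + d))
    (hpy : IsProxPt (f'' y) g (f'' y *ᵥ y - f' y) (y + d')) :
    mNorm (f'' y) d' ≤ 4 * l ^ 2 := by
  have hl0 : 0 ≤ l := hl ▸ Real.sqrt_nonneg _
  set α := (1 + l)⁻¹ with hα
  have hαl : α * (1 + l) = 1 := inv_mul_cancel₀ (by positivity)
  have hα0 : 0 < α := by positivity
  have hα1 : 4 / 5 ≤ α := by nlinarith
  have hα2 : α ≤ 1 := by nlinarith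
  have hr : mNorm (f'' x) (α • d) = α * l := by rw [mNorm_smul _ hα0.le, hl]
  have hrl : α * l / (1 - α * l) = l := by
    have h1 : 1 - α * l = α := by linarith
    rw [h1, mul_div_cancel_left₀ _ hα0.ne']
  have hseg : ∀ t ∈ Icc (0 : ℝ) 1, x + t • (α • d) ∈ D := fun t ht => by
    have := S.sc.2.1.add_smul_sub_mem hx hy ht
    rwa [hyx, add_sub_cancel_left] at this
  have hL : ∀ t ∈ Icc (0 : ℝ) 1, mNorm (f'' (x + t • (α • d))) (α • d) ≤ l := fun t ht => by
    have := S.sqrt_quad_line_le hseg (by change mNorm (f'' x) (α • d) < 1; rw [hr]; linarith) ht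
    change _ ≤ mNorm (f'' x) (α • d) / (1 - mNorm (f'' x) (α • d)) at this
    rwa [hr, hrl] at this
  have h1 : (1 : ℝ) ∈ Icc (0 : ℝ) 1 := by simp
  have hy1 : x + (1 : ℝ) • (α • d) = y := by rw [one_smul, hyx]
  obtain ⟨htx, hvx⟩ := hpx.variational (S.hess_symm hx) hproper hconv
  obtain ⟨hty, hvy⟩ := hpy.variational (S.hess_symm hy) hproper hconv
  have v1 := hvx _ hty
  have v2 := hvy _ htx
  set w := d' - (1 - α) • d with hw
  have hw1 : y + d' - (x + d) = w := by rw [hyx, hw]; module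
  have hw2 : x + d - (y + d') = -w := by rw [← hw1]; abel
  rw [hw1] at v1
  rw [hw2] at v2
  simp only [mulVec_add, dotProduct_sub, dotProduct_add, neg_dotProduct] at v1 v2
  have hgr := (abs_le.1 (S.abs_grad_sub_le hseg hl0 hl1 hL w)).1
  have hhs := (abs_le.1 (S.abs_hess_sub_le hseg hl0 hl1 hL w d h1)).1
  have hcmp := (S.quad_line_mem_Icc hseg hL w h1).1
  have hloc := hL 1 h1
  rw [hy1] at hhs hcmp hloc
  rw [← hyx] at hgr
  rw [mNorm_smul _ hα0.le] at hloc
  change -(55 / 32 * l * mNorm (f'' x) w * mNorm (f'' x) (α • d)) ≤ _ at hgr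
  rw [hr, mulVec_smul, dotProduct_smul, smul_eq_mul] at hgr
  change -(55 / 16 * l * 1 * mNorm (f'' x) w * mNorm (f'' x) d) ≤ _ at hhs
  rw [← hl] at hhs
  have hW0 : mNorm (f'' x) w ^ 2 = w ⬝ᵥ f'' x *ᵥ w := Real.sq_sqrt (S.hess_nonneg hx w)
  have hW1 : mNorm (f'' y) w ^ 2 = w ⬝ᵥ f'' y *ᵥ w := Real.sq_sqrt (S.hess_nonneg hy w)
  have hW0n : 0 ≤ mNorm (f'' x) w := Real.sqrt_nonneg _
  have hW1n : 0 ≤ mNorm (f'' y) w := Real.sqrt_nonneg _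
  rw [← hW0, ← hW1, Real.exp_neg, inv_mul_le_iff₀ (Real.exp_pos _)] at hcmp
  have hexp : Real.exp (5 / 2 * l * 1) ≤ 1.351 ^ 2 :=
    (exp_le_one_add_mul (by positivity) (by linarith)).trans (by norm_num; linarith)
  have hW01 : mNorm (f'' x) w ≤ 1.351 * mNorm (f'' y) w := by
    refine le_of_sq_le_sq ?_ (by positivity)
    rw [mul_pow]
    exact hcmp.trans (mul_le_mul_of_nonneg_right hexp (sq_nonneg _))
  have hwd : w ⬝ᵥ f'' y *ᵥ w = w ⬝ᵥ f'' y *ᵥ d' - (1 - α) * (w ⬝ᵥ f'' y *ᵥ d) := by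
    conv_lhs => rw [hw, mulVec_sub, ← hw, dotProduct_sub, mulVec_smul, dotProduct_smul, smul_eq_mul]
  have hhs' := mul_le_mul_of_nonneg_left hhs (sub_nonneg.2 hα2)
  have hmain : mNorm (f'' y) w ^ 2 ≤ 55 / 16 * l ^ 2 * mNorm (f'' x) w * (1 - α / 2) := by
    rw [hW1, hwd]
    linarith
  have hsq : mNorm (f'' y) w ^ 2 ≤ 2.8 * l ^ 2 * mNorm (f'' y) w := by
    calc _ ≤ 55 / 16 * l ^ 2 * mNorm (f'' x) w * (1 - α / 2) := hmain
      _ ≤ 55 / 16 * l ^ 2 * (1.351 * mNorm (f'' y) w) * (3 / 5) := by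
        gcongr
        · linarith
        · linarith
      _ ≤ _ := by
        have : 0 ≤ l ^ 2 * mNorm (f'' y) w := by positivity
        linarith
  have hwle : mNorm (f'' y) w ≤ 2.8 * l ^ 2 := by
    rcases hW1n.eq_or_lt with h | h
    · rw [← h]; positivity
    · rw [sq] at hsq
      exact le_of_mul_le_mul_right hsq h
  have hdy : (1 - α) * mNorm (f'' y) d ≤ l ^ 2 := by
    have : 1 - α = l * α := by linarith
    rw [this, mul_assoc, sq]
    exact mul_le_mul_of_nonneg_left hloc hl0
  have hd' : d' = w + (1 - α) • d := by rw [hw]; abel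
  calc mNorm (f'' y) d' ≤ mNorm (f'' y) w + mNorm (f'' y) ((1 - α) • d) := by
        conv_lhs => rw [hd']
        exact S.mNorm_add_le hy _ _
    _ ≤ 4 * l ^ 2 := by
        rw [mNorm_smul _ (sub_nonneg.2 hα2)]
        linarith [sq_nonneg l]

/-- For the damped proximal-Newton scheme with `α_k = (1 + λ_k)⁻¹`, if
`λ₀ ≤ σ̄ := √5 − 2` then `λ_{k+1} ≤ λ_k`, `λ_{k+1} ≤ (2/(1 − 2σ̄ − σ̄²)) λ_k²`, and `λ_k → 0`
at a quadratic rate. -/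
theorem damped_newton_quadratic_convergence
    (n : ℕ) (D : Set (Fin n → ℝ)) (f : (Fin n → ℝ) → ℝ)
    (f' : (Fin n → ℝ) → Fin n → ℝ)
    (f'' : (Fin n → ℝ) → Matrix (Fin n) (Fin n) ℝ)
    (hf : StdSelfConcordantOn D f)
    (hgrad : ∀ x ∈ D, HasFDerivAt f (dotCLM (f' x)) x)
    (hhess : ∀ x ∈ D,
      HasFDerivAt f' (LinearMap.toContinuousLinearMap (f'' x).mulVecLin) x)
    (g : (Fin n → ℝ) → EReal) (hg_proper : EProper g)
    (hg_lsc : LowerSemicontinuous g) (hg_conv : EConvex g)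
    (x d : ℕ → Fin n → ℝ) (lam : ℕ → ℝ)
    (hdom : ∀ k, x k ∈ D ∧ g (x k) ≠ ⊤)
    (hpd : ∀ k, (f'' (x k)).PosDef)
    (hprox : ∀ k,
      IsProxPt (f'' (x k)) g ((f'' (x k)).mulVec (x k) - f' (x k)) (x k + d k))
    (hlam : ∀ k, lam k = mNorm (f'' (x k)) (d k))
    (hupd : ∀ k, x (k + 1) = x k + (1 + lam k)⁻¹ • d k)
    (xs : Fin n → ℝ) (hxsD : xs ∈ D) (hxsg : g xs ≠ ⊤)
    (hxs_min : ∀ y, Fext D f g xs ≤ Fext D f g y)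
    (hxs_uniq : ∀ y, (∀ z, Fext D f g y ≤ Fext D f g z) → y = xs)
    (hxs_pd : (f'' xs).PosDef)
    (hlam0 : lam 0 ≤ Real.sqrt 5 - 2) :
    (∀ k, lam (k + 1) ≤ lam k) ∧
      (∀ k, lam (k + 1) ≤
        2 / (1 - 2 * (Real.sqrt 5 - 2) - (Real.sqrt 5 - 2) ^ 2) * lam k ^ 2) ∧
      Tendsto lam atTop (𝓝 0) := by
  have S : SelfConcordantSystem D f f' f'' := ⟨hf, hgrad, hhess⟩
  have h5 : √5 < 2.2361 := (Real.sqrt_lt' (by norm_num)).2 (by norm_num)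
  have h5' : 2.236 < √5 := Real.lt_sqrt_of_sq_lt (by norm_num)
  have h5s : √5 ^ 2 = 5 := Real.sq_sqrt (by norm_num)
  have hl0 : ∀ k, 0 ≤ lam k := fun k => hlam k ▸ Real.sqrt_nonneg _
  have hstep : ∀ k, lam k ≤ 6 / 25 → lam (k + 1) ≤ 4 * lam k ^ 2 := fun k hk => by
    rw [hlam (k + 1)]
    exact S.mNorm_step_le hg_proper hg_conv (hdom k).1 (hdom (k + 1)).1 (hlam k) hk (hupd k)
      (hprox k) (hprox (k + 1))
  have hsmall : ∀ k, lam k ≤ 6 / 25 := by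
    intro k
    induction k with
    | zero => linarith
    | succ k ih => nlinarith [hstep k ih, hl0 k]
  have hcontr : ∀ k, lam (k + 1) ≤ 24 / 25 * lam k := fun k => by
    nlinarith [hstep k (hsmall k), hl0 k, hsmall k]
  refine ⟨fun k => by linarith [hcontr k, hl0 k], fun k => ?_, ?_⟩
  · refine (hstep k (hsmall k)).trans (mul_le_mul_of_nonneg_right ?_ (sq_nonneg _))
    rw [le_div_iff₀ (by nlinarith)]
    nlinarith
  · have hgeom : ∀ k, lam k ≤ (24 / 25) ^ k * lam 0 := by
      intro k
      induction k with
      | zero => simp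
      | succ k ih => rw [pow_succ']; linarith [hcontr k]
    refine squeeze_zero hl0 hgeom ?_
    simpa using (tendsto_pow_atTop_nhds_zero_of_lt_one (r := (24 / 25 : ℝ)) (by norm_num)
      (by norm_num)).mul_const (lam 0)
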